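/- (Uniqueness infrastructure for Theorem 6.4 / equation (2).) Let f ∈ R be nonzero. Define B_f ⊆ K[X] to be the set of all polynomials b such that there exists a finitely supported function c : (Fin n →₀ ℕ) →₀ R[Y] with Σ_β c(β)(m) · ∂^β(f^{m+1}) = b(m) · f^m in R for every natural number m. Then B_f is an ideal of the polynomial ring K[X]; in particular (being nonzero by Bernstein's theorem) it has a unique monic generator of minimal degree, the Bernstein–Sato polynomial b_f of f. -/

import Mathlib

open MvPolynomial

variable {K : Type*} [Field K] [CharZero K] {n : ℕ}

/-- The partial-derivative endomorphism with respect to `x_i`. -/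
noncomputable def pd (i : Fin n) : Module.End K (MvPolynomial (Fin n) K) :=
  (pderiv i).toLinearMap

/-- The higher-derivative operator `∂^β = ∏_i (pderiv i)^{β(i)}` (the factors commute,
so the order of composition is irrelevant). -/
noncomputable def dpow (β : Fin n →₀ ℕ) : Module.End K (MvPolynomial (Fin n) K) :=
  (List.ofFn fun i : Fin n => (pd i) ^ (β i)).prod

open scoped IsMulCommutative in
theorem exists_algHom_X_eq {σ k A : Type*} [CommRing k] [Ring A] [Algebra k A] (y : σ → A)
    (hy : ∀ i j, y i * y j = y j * y i) :
    ∃ Φ : MvPolynomial σ k →ₐ[k] A, ∀ i, Φ (X i) = y i := by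
  have hc : ∀ a ∈ Set.range y, ∀ b ∈ Set.range y, a * b = b * a := by
    rintro _ ⟨i, rfl⟩ _ ⟨j, rfl⟩
    exact hy i j
  have := Algebra.isMulCommutative_adjoin k hc
  refine ⟨(Algebra.adjoin k (Set.range y)).val.comp
    (aeval fun i => ⟨y i, Algebra.subset_adjoin ⟨i, rfl⟩⟩), fun i => ?_⟩
  simp

theorem exists_normalOrdering {σ k A : Type*} [CommRing k] [Ring A] [Algebra k A] (x d : σ → A)
    (hxx : ∀ i j, x i * x j = x j * x i) (hdd : ∀ i j, d i * d j = d j * d i) :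
    ∃ op : MvPolynomial (σ ⊕ σ) k →ₗ[k] A, op 1 = 1 ∧
      (∀ i p, op (p * X (Sum.inl i)) = x i * op p) ∧
      (∀ i p, op (p * X (Sum.inr i)) = op p * d i) := by
  obtain ⟨Φ, hΦ⟩ := exists_algHom_X_eq (k := k) x hxx
  obtain ⟨Ψ, hΨ⟩ := exists_algHom_X_eq (k := k) d hdd
  let e := Finsupp.sumFinsuppAddEquivProdFinsupp (M := ℕ) (α := σ) (β := σ)
  let op : MvPolynomial (σ ⊕ σ) k →ₗ[k] A := (basisMonomials (σ ⊕ σ) k).constr k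
    fun γ => Φ (monomial (e γ).1 1) * Ψ (monomial (e γ).2 1)
  have hop : ∀ γ, op (monomial γ 1) = Φ (monomial (e γ).1 1) * Ψ (monomial (e γ).2 1) := by
    intro γ
    have := (basisMonomials (σ ⊕ σ) k).constr_basis k
      (fun γ => Φ (monomial (e γ).1 1) * Ψ (monomial (e γ).2 1)) γ
    simpa using this
  have el : ∀ i, e (Finsupp.single (Sum.inl i) 1) = (Finsupp.single i 1, 0) := by
    intro i
    ext j <;> simp [e]
  have er : ∀ i, e (Finsupp.single (Sum.inr i) 1) = (0, Finsupp.single i 1) := by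
    intro i
    ext j <;> simp [e]
  refine ⟨op, ?_, fun i p => ?_, fun i p => ?_⟩
  · have := hop 0
    simpa using this
  · induction p using MvPolynomial.induction_on' with
    | monomial γ a =>
      have : (monomial γ a : MvPolynomial (σ ⊕ σ) k) = a • monomial γ 1 := by
        simp [smul_monomial]
      rw [this, smul_mul_assoc, map_smul, map_smul, X, monomial_mul, one_mul, hop, hop, map_add, el,
        mul_smul_comm, ← mul_assoc, ← hΦ, ← map_mul, X, monomial_mul]
      simp [add_comm]
    | add p q hp hq => rw [add_mul, map_add, hp, hq, map_add, mul_add]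
  · induction p using MvPolynomial.induction_on' with
    | monomial γ a =>
      have : (monomial γ a : MvPolynomial (σ ⊕ σ) k) = a • monomial γ 1 := by
        simp [smul_monomial]
      rw [this, smul_mul_assoc, map_smul, map_smul, X, monomial_mul, one_mul, hop, hop, map_add, er,
        smul_mul_assoc, mul_assoc (Φ _), ← hΨ, ← map_mul, X, monomial_mul]
      simp
    | add p q hp hq => rw [add_mul, map_add, hp, hq, map_add, add_mul]

theorem totalDegree_pderiv_le {σ k : Type*} [CommSemiring k] (i : σ)
    (p : MvPolynomial σ k) : (pderiv i p).totalDegree ≤ p.totalDegree - 1 := by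
  classical
  refine Finset.sup_le fun m hm => ?_
  rw [mem_support_iff, coeff_pderiv] at hm
  have h1 : m + Finsupp.single i 1 ∈ p.support := by
    rw [mem_support_iff]
    exact left_ne_zero_of_mul hm
  have := le_totalDegree h1
  rw [Finsupp.sum_add_index' (by simp) (by simp), Finsupp.sum_single_index rfl] at this
  omega

theorem eq_C_of_pderiv_eq_zero {σ k : Type*} [CommRing k] [IsDomain k] [CharZero k]
    {p : MvPolynomial σ k} (h : ∀ i, pderiv i p = 0) : p = C (coeff 0 p) := by
  classical
  ext m
  rw [coeff_C]
  split_ifs with hm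
  · rw [hm]
  · obtain ⟨i, hi⟩ := Finsupp.ne_iff.mp (Ne.symm hm)
    have hle : Finsupp.single i 1 ≤ m := by
      rw [Finsupp.single_le_iff]
      exact Nat.one_le_iff_ne_zero.mpr hi
    have := coeff_pderiv (i := i) p (m - Finsupp.single i 1)
    rw [h i, coeff_zero, tsub_add_cancel_of_le hle] at this
    refine (mul_eq_zero.mp this.symm).resolve_right ?_
    exact Nat.cast_add_one_ne_zero _

/-- Bernstein's inequality for a filtered module over the Weyl algebra. -/
theorem bernstein_inequality {σ k V : Type*} [Fintype σ] [DecidableEq σ] [Field k] [CharZero k]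
    [AddCommGroup V] [Module k V] (x d : σ → Module.End k V)
    (hxx : ∀ i j, x i * x j = x j * x i) (hdd : ∀ i j, d i * d j = d j * d i)
    (hdx : ∀ i j, d i * x j = x j * d i + if i = j then 1 else 0)
    (Γ : ℕ → Submodule k V) (hmono : Monotone Γ)
    (hx : ∀ i m, ∀ v ∈ Γ m, x i v ∈ Γ (m + 1)) (hd : ∀ i m, ∀ v ∈ Γ m, d i v ∈ Γ (m + 1))
    (h0 : Γ 0 ≠ ⊥) (e : ℕ)
    (hfin : Module.Finite k (Γ (2 * (2 * Fintype.card σ * e)))) :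
    (e + 1) ^ Fintype.card σ ≤ Module.finrank k (Γ (2 * (2 * Fintype.card σ * e))) := by
  obtain ⟨op, op1, opx, opd⟩ := exists_normalOrdering (k := k) x d hxx hdd
  have comm_d : ∀ i p, d i * op p = op p * d i + op (pderiv (Sum.inl i) p) := by
    intro i p
    induction p using MvPolynomial.induction_on with
    | C a =>
      rw [← mul_one (C a), ← smul_eq_C_mul]
      simp [op1]
    | add p q hp hq => simp only [map_add, mul_add, add_mul, hp, hq]; abel
    | mul_X p j hp =>
      rcases j with j | j
      · rw [pderiv_mul, map_add, opx, opx, ← mul_assoc, hdx, add_mul, mul_assoc, hp,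
          pderiv_X, Pi.single_apply]
        by_cases hij : i = j
        · simp [hij, mul_add, mul_assoc, add_assoc]
        · simp [hij, Ne.symm hij, mul_add, mul_assoc]
      · rw [pderiv_mul, map_add, opd, opd, ← mul_assoc, hp, pderiv_X_of_ne (by simp),
          add_mul, mul_assoc, mul_assoc, hdd]
        simp
  have comm_x : ∀ i p, op p * x i = x i * op p + op (pderiv (Sum.inr i) p) := by
    intro i p
    induction p using MvPolynomial.induction_on with
    | C a =>
      rw [← mul_one (C a), ← smul_eq_C_mul]
      simp [op1]
    | add p q hp hq => simp only [map_add, mul_add, add_mul, hp, hq]; abel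
    | mul_X p j hp =>
      rcases j with j | j
      · rw [pderiv_mul, map_add, opx, opx, mul_assoc, hp, pderiv_X_of_ne (by simp),
          mul_add, ← mul_assoc, ← mul_assoc, hxx]
        simp
      · rw [pderiv_mul, map_add, opd, opd, mul_assoc, hdx, mul_add, ← mul_assoc, hp,
          pderiv_X, Pi.single_apply]
        by_cases hij : i = j
        · simp [hij, add_mul, mul_assoc, add_assoc]
        · simp [Ne.symm hij, add_mul, mul_assoc]
  have faithful : ∀ m, ∀ p : MvPolynomial (σ ⊕ σ) k, p.totalDegree ≤ m →
      (∀ v ∈ Γ m, op p v = 0) → p = 0 := by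
    obtain ⟨v₀, hv₀, hne⟩ := Submodule.exists_mem_ne_zero_of_ne_bot h0
    intro m
    induction m with
    | zero =>
      intro p hp hv
      rw [totalDegree_eq_zero_iff_eq_C.mp (Nat.le_zero.mp hp), ← mul_one (C _), ← smul_eq_C_mul]
      have := hv v₀ hv₀
      rw [totalDegree_eq_zero_iff_eq_C.mp (Nat.le_zero.mp hp), ← mul_one (C _), ← smul_eq_C_mul,
        map_smul, op1, LinearMap.smul_apply, Module.End.one_apply, smul_eq_zero] at this
      rw [this.resolve_right hne, zero_smul]
    | succ m ih =>
      intro p hp hv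
      have hder : ∀ j, pderiv j p = 0 := by
        intro j
        refine ih _ ((totalDegree_pderiv_le j p).trans (by omega)) fun v hvm => ?_
        have hvs := hmono (Nat.le_succ m) hvm
        rcases j with j | j
        · have h := LinearMap.congr_fun (comm_d j p) v
          simpa [hv v hvs, hv _ (hd j m v hvm)] using h.symm
        · have h := LinearMap.congr_fun (comm_x j p) v
          simpa [hv v hvs, hv _ (hx j m v hvm)] using h.symm
      refine ih p ?_ fun v hvm => hv v (hmono (Nat.le_succ m) hvm)
      rw [eq_C_of_pderiv_eq_zero hder]
      simp
  have hdeg : ∀ p : MvPolynomial (σ ⊕ σ) k, ∀ m r, p.totalDegree ≤ r → ∀ v ∈ Γ m,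
      op p v ∈ Γ (m + r) := by
    have hmon : ∀ r, ∀ γ : σ ⊕ σ →₀ ℕ, γ.degree = r → ∀ m, ∀ v ∈ Γ m,
        op (monomial γ 1) v ∈ Γ (m + r) := by
      intro r
      induction r with
      | zero =>
        intro γ hγ m v hv
        rw [(Finsupp.degree_eq_zero_iff γ).mp hγ, monomial_zero', C_1, op1]
        exact hv
      | succ r ih =>
        intro γ hγ m v hv
        obtain ⟨j, hj⟩ : ∃ j, γ j ≠ 0 := by
          by_contra! hall
          rw [show γ = 0 from Finsupp.ext hall] at hγ
          simp at hγ
        have hle : Finsupp.single j 1 ≤ γ :=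
          Finsupp.single_le_iff.mpr (Nat.one_le_iff_ne_zero.mpr hj)
        obtain ⟨δ, rfl⟩ := exists_add_of_le hle
        have hδ : δ.degree = r := by
          rw [map_add, Finsupp.degree_single] at hγ
          omega
        have hmul : (monomial (Finsupp.single j 1 + δ) 1 : MvPolynomial (σ ⊕ σ) k) =
            monomial δ 1 * X j := by
          rw [X, monomial_mul, one_mul, add_comm]
        rw [hmul]
        rcases j with j | j
        · rw [opx]
          exact hx _ _ _ (ih δ hδ m v hv)
        · rw [opd, ← add_assoc, add_right_comm]
          exact ih δ hδ _ _ (hd _ _ _ hv)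
    intro p m r hp v hv
    rw [p.as_sum, map_sum, LinearMap.sum_apply]
    refine Submodule.sum_mem _ fun γ hγ => ?_
    rw [← mul_one (coeff γ p), ← smul_eq_mul, ← smul_monomial, map_smul]
    refine Submodule.smul_mem _ _ (hmono ?_ (hmon _ γ rfl m v hv))
    have := (le_totalDegree hγ).trans hp
    exact Nat.add_le_add_left this m
  set D := 2 * Fintype.card σ * e with hD
  have hle : Γ D ≤ Γ (2 * D) := hmono (by omega)
  have hfinD : Module.Finite k (Γ D) := Submodule.finiteDimensional_of_le hle
  let res : MvPolynomial.restrictTotalDegree (σ ⊕ σ) k D →ₗ[k] (Γ D →ₗ[k] Γ (2 * D)) :=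
    { toFun := fun p => (op p.1).restrict fun v hv => by
        have := hdeg p.1 D D ((mem_restrictTotalDegree _ _ _).mp p.2) v hv
        rwa [← two_mul] at this
      map_add' := fun p q => by ext v; simp
      map_smul' := fun a p => by ext v; simp }
  have res_inj : Function.Injective res := by
    rw [← LinearMap.ker_eq_bot, LinearMap.ker_eq_bot']
    intro p hp
    refine Subtype.ext (faithful D p.1 ((mem_restrictTotalDegree _ _ _).mp p.2) fun v hv => ?_)
    have := congrArg Subtype.val (LinearMap.congr_fun hp ⟨v, hv⟩)
    simpa [res] using this
  let mon : (σ ⊕ σ → Fin (e + 1)) → MvPolynomial.restrictTotalDegree (σ ⊕ σ) k D := fun γ =>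
    ⟨monomial (Finsupp.equivFunOnFinite.symm fun j => (γ j : ℕ)) 1, by
      rw [mem_restrictTotalDegree]
      refine (totalDegree_monomial_le _ _).trans ?_
      rw [Finsupp.sum_fintype _ _ fun _ => rfl]
      refine (Finset.sum_le_card_nsmul _ _ e fun j _ => Nat.lt_succ_iff.mp (γ j).2).trans ?_
      simp [hD, two_mul]⟩
  have mon_indep : LinearIndependent k mon := by
    refine LinearIndependent.of_comp (Submodule.subtype _) ?_
    have h := (basisMonomials (σ ⊕ σ) k).linearIndependent.comp
      (fun γ : σ ⊕ σ → Fin (e + 1) => Finsupp.equivFunOnFinite.symm fun j => (γ j : ℕ))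
      fun γ δ h => funext fun j => Fin.ext (congrFun (Finsupp.equivFunOnFinite.symm.injective h) j)
    simpa [Function.comp_def, mon] using h
  have hcard := (mon_indep.map' res (LinearMap.ker_eq_bot.mpr res_inj)).fintype_card_le_finrank
  rw [Module.finrank_linearMap] at hcard
  have h2 := Submodule.finrank_mono hle
  refine Nat.mul_self_le_mul_self_iff.mp (le_trans (le_of_eq ?_)
    (hcard.trans (Nat.mul_le_mul_right _ h2)))
  simp [pow_add]

theorem finrank_map_mkQ_add_finrank_inf {k M : Type*} [Field k] [AddCommGroup M] [Module k M]
    (W N : Submodule k M) [Module.Finite k W] :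
    Module.finrank k (W.map N.mkQ) + Module.finrank k (W ⊓ N : Submodule k M) =
      Module.finrank k W := by
  rw [← LinearMap.finrank_range_add_finrank_ker (N.mkQ.domRestrict W),
    LinearMap.range_domRestrict, LinearMap.ker_domRestrict, Submodule.ker_mkQ,
    ← Submodule.map_comap_subtype, Submodule.finrank_map_subtype_eq]

/-- In a descending chain of submodules over the Weyl algebra, the number of initial steps at which
a given vector leaves the chain is bounded by the growth of a filtration. -/
theorem exists_mem_succ_of_finrank_lt {σ k M : Type*} [Fintype σ] [DecidableEq σ] [Field k]
    [CharZero k] [AddCommGroup M] [Module k M] (x d : σ → Module.End k M)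
    (hxx : ∀ i j, x i * x j = x j * x i) (hdd : ∀ i j, d i * d j = d j * d i)
    (hdx : ∀ i j, d i * x j = x j * d i + if i = j then 1 else 0)
    (F : ℕ → Submodule k M) (hF : Monotone F)
    (hFx : ∀ i m, ∀ v ∈ F m, x i v ∈ F (m + 1)) (hFd : ∀ i m, ∀ v ∈ F m, d i v ∈ F (m + 1))
    (N : ℕ → Submodule k M) (hN : Antitone N)
    (hNx : ∀ i m, ∀ v ∈ N m, x i v ∈ N m) (hNd : ∀ i m, ∀ v ∈ N m, d i v ∈ N m)
    (e L : ℕ) (hfin : Module.Finite k (F (2 * (2 * Fintype.card σ * e))))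
    (hlt : Module.finrank k (F (2 * (2 * Fintype.card σ * e))) <
      L * (e + 1) ^ Fintype.card σ)
    (v : ℕ → M) (hvF : ∀ j < L, v j ∈ F 0) (hvN : ∀ j < L, v j ∈ N j) :
    ∃ j < L, v j ∈ N (j + 1) := by
  by_contra! hcon
  set T := 2 * (2 * Fintype.card σ * e) with hT
  have hfinj : ∀ j, Module.Finite k (F T ⊓ N j : Submodule k M) := fun j =>
    Submodule.finiteDimensional_of_le inf_le_left
  have step : ∀ j < L, (e + 1) ^ Fintype.card σ +
      Module.finrank k (F T ⊓ N (j + 1) : Submodule k M) ≤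
      Module.finrank k (F T ⊓ N j : Submodule k M) := by
    intro j hj
    have hinf : F T ⊓ N (j + 1) = F T ⊓ N j ⊓ N (j + 1) := by
      rw [inf_assoc, inf_eq_right.mpr (hN (Nat.le_succ j))]
    rw [hinf, ← finrank_map_mkQ_add_finrank_inf (F T ⊓ N j) (N (j + 1))]
    refine Nat.add_le_add_right ?_ _
    refine bernstein_inequality (fun i => (N (j + 1)).mapQ _ (x i) (hNx i _))
      (fun i => (N (j + 1)).mapQ _ (d i) (hNd i _)) ?_ ?_ ?_
      (fun m => (F m ⊓ N j).map (N (j + 1)).mkQ) ?_ ?_ ?_ ?_ e inferInstance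
    · intro i l
      ext w
      exact congrArg Submodule.Quotient.mk (LinearMap.congr_fun (hxx i l) w)
    · intro i l
      ext w
      exact congrArg Submodule.Quotient.mk (LinearMap.congr_fun (hdd i l) w)
    · intro i l
      ext w
      have := congrArg (Submodule.Quotient.mk (p := N (j + 1))) (LinearMap.congr_fun (hdx i l) w)
      split_ifs at this ⊢ <;> exact this
    · exact fun a b hab => Submodule.map_mono (inf_le_inf_right _ (hF hab))
    · rintro i m _ ⟨w, hw, rfl⟩
      exact ⟨x i w, ⟨hFx i m w hw.1, hNx i j w hw.2⟩, rfl⟩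
    · rintro i m _ ⟨w, hw, rfl⟩
      exact ⟨d i w, ⟨hFd i m w hw.1, hNd i j w hw.2⟩, rfl⟩
    · intro h
      refine hcon j hj ?_
      rw [← Submodule.Quotient.mk_eq_zero, ← Submodule.mem_bot k, ← h]
      exact ⟨v j, ⟨hvF j hj, hvN j hj⟩, rfl⟩
  have total : ∀ j ≤ L, j * (e + 1) ^ Fintype.card σ +
      Module.finrank k (F T ⊓ N j : Submodule k M) ≤ Module.finrank k (F T) := by
    intro j
    induction j with
    | zero =>
      intro _
      rw [zero_mul, zero_add]
      exact Submodule.finrank_mono inf_le_left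
    | succ j ih =>
      intro hj
      have h1 := ih (by omega)
      have h2 := step j (by omega)
      rw [Nat.succ_mul]
      omega
  have := total L le_rfl
  omega

/-- The sequences `ℕ → K[x]`, as a `K[s]`-module on which `s` acts at index `m` as `m`. -/
def PolySeq (σ k : Type*) [Field k] : Type _ := ℕ → MvPolynomial σ k

namespace PolySeq

variable {σ k : Type*} [Field k]

noncomputable instance : AddCommGroup (PolySeq σ k) :=
  inferInstanceAs (AddCommGroup (ℕ → MvPolynomial σ k))

/-- Evaluation of a polynomial at all natural numbers. -/
noncomputable def evalNat (σ k : Type*) [Field k] :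
    Polynomial k →+* (ℕ → MvPolynomial σ k) :=
  RingHom.pi fun m => C.comp (Polynomial.evalRingHom (m : k))

noncomputable instance : Module (Polynomial k) (PolySeq σ k) :=
  Module.compHom (ℕ → MvPolynomial σ k) (evalNat σ k)

theorem add_apply (v w : PolySeq σ k) (m : ℕ) : (v + w) m = v m + w m := rfl

theorem smul_apply (p : Polynomial k) (v : PolySeq σ k) (m : ℕ) :
    (p • v) m = C (p.eval (m : k)) * v m := rfl

theorem mem_of_apply_eq {P : Submodule (Polynomial k) (PolySeq σ k)} {v w : PolySeq σ k}
    (hv : v ∈ P) (h : ∀ m, w m = v m) : w ∈ P := by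
  rwa [show w = v from _root_.funext h]

/-- A linear endomorphism of `K[x]` acting termwise on sequences. -/
noncomputable def termwise :
    Module.End k (MvPolynomial σ k) →+* Module.End (Polynomial k) (PolySeq σ k) where
  toFun φ :=
    { toFun := fun v m => φ (v m)
      map_add' := fun v w => funext fun m => map_add φ (v m) (w m)
      map_smul' := fun p v => funext fun m => by
        change φ (C _ * v m) = C _ * φ (v m)
        rw [← smul_eq_C_mul, map_smul, smul_eq_C_mul]
        rfl }
  map_one' := rfl
  map_mul' _ _ := rfl
  map_zero' := rfl
  map_add' _ _ := rfl

theorem termwise_apply (φ : Module.End k (MvPolynomial σ k)) (v : PolySeq σ k) (m : ℕ) :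
    termwise φ v m = φ (v m) := rfl

/-- The sequence `m ↦ f ^ (m + a)`. -/
noncomputable def pow (f : MvPolynomial σ k) (a : ℕ) : PolySeq σ k := fun m => f ^ (m + a)

/-- The localization of the module of sequences at the nonzero polynomials in `s`. -/
abbrev Loc (σ k : Type*) [Field k] : Type _ :=
  LocalizedModule (nonZeroDivisors (Polynomial k)) (PolySeq σ k)

/-- The localization map. -/
noncomputable abbrev toLoc : PolySeq σ k →ₗ[Polynomial k] Loc σ k :=
  LocalizedModule.mkLinearMap (nonZeroDivisors (Polynomial k)) (PolySeq σ k)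

/-- The action of endomorphisms of `K[x]` on the localized module of sequences. -/
noncomputable def locAct : Module.End k (MvPolynomial σ k) →+*
    Module.End (FractionRing (Polynomial k)) (Loc σ k) where
  toFun φ := IsLocalizedModule.mapExtendScalars (nonZeroDivisors (Polynomial k)) toLoc toLoc
    (FractionRing (Polynomial k)) (termwise φ)
  map_one' := by
    ext v
    obtain ⟨⟨v, s⟩, rfl⟩ := IsLocalizedModule.mk'_surjective (nonZeroDivisors (Polynomial k)) toLoc v
    simp
  map_mul' φ ψ := by
    ext v
    obtain ⟨⟨v, s⟩, rfl⟩ := IsLocalizedModule.mk'_surjective (nonZeroDivisors (Polynomial k)) toLoc v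
    simp
  map_zero' := by simp
  map_add' φ ψ := by simp

theorem locAct_toLoc (φ : Module.End k (MvPolynomial σ k)) (v : PolySeq σ k) :
    locAct φ (toLoc v) = toLoc (termwise φ v) :=
  IsLocalizedModule.map_apply _ _ _ _ _

end PolySeq

variable {k : Type*} [Field k]

theorem pd_mul_pd_comm (i j : Fin n) :
    (pd i * pd j : Module.End k (MvPolynomial (Fin n) k)) = pd j * pd i := by
  have h : ⁅pderiv (R := k) i, pderiv (R := k) j⁆ = 0 := by
    refine derivation_ext fun l => ?_
    simp only [Derivation.commutator_apply, pderiv_X, Pi.single_apply]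
    split_ifs <;> simp
  refine LinearMap.ext fun p => ?_
  have := DFunLike.congr_fun h p
  rw [Derivation.commutator_apply] at this
  exact sub_eq_zero.mp this

theorem pd_mul_mulLeft (i : Fin n) (g : MvPolynomial (Fin n) k) :
    pd i * LinearMap.mulLeft k g =
      LinearMap.mulLeft k g * pd i + LinearMap.mulLeft k (pderiv i g) := by
  refine LinearMap.ext fun p => ?_
  simp [pd, Derivation.leibniz, mul_comm]

theorem mulLeft_mul_mulLeft (g h : MvPolynomial (Fin n) k) :
    LinearMap.mulLeft k g * LinearMap.mulLeft k h = LinearMap.mulLeft k (g * h) := by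
  refine LinearMap.ext fun p => ?_
  simp

theorem dpow_zero : (dpow 0 : Module.End k (MvPolynomial (Fin n) k)) = 1 := by
  simp [dpow]

theorem pd_mul_dpow (i : Fin n) (β : Fin n →₀ ℕ) :
    (pd i * dpow β : Module.End k (MvPolynomial (Fin n) k)) =
      dpow (β + Finsupp.single i 1) := by
  obtain ⟨Φ, hΦ⟩ := exists_algHom_X_eq (k := k)
    (pd : Fin n → Module.End k (MvPolynomial (Fin n) k)) pd_mul_pd_comm
  have h : ∀ γ : Fin n →₀ ℕ, dpow γ = Φ (monomial γ 1) := by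
    intro γ
    rw [monomial_eq, C_1, one_mul, Finsupp.prod_fintype _ _ (by simp), ← List.prod_ofFn,
      map_list_prod, List.map_ofFn, dpow]
    congr 2
    ext1 l
    simp [hΦ]
  rw [h, h, ← hΦ, ← map_mul, X, monomial_mul, one_mul, add_comm]

namespace PolySeq

/-- The `k[s]`-submodule of sequences generated from `h` by polynomial differential operators. -/
noncomputable def opSpan (h : PolySeq (Fin n) k) : Submodule (Polynomial k) (PolySeq (Fin n) k) :=
  Submodule.span (Polynomial k) (Set.range fun q : MvPolynomial (Fin n) k × (Fin n →₀ ℕ) =>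
    termwise (LinearMap.mulLeft k q.1 * dpow q.2) h)

theorem termwise_mem_opSpan (g : MvPolynomial (Fin n) k) (β : Fin n →₀ ℕ)
    (h : PolySeq (Fin n) k) : termwise (LinearMap.mulLeft k g * dpow β) h ∈ opSpan h :=
  Submodule.subset_span ⟨(g, β), rfl⟩

theorem mulLeft_mem_opSpan (g : MvPolynomial (Fin n) k) {h v : PolySeq (Fin n) k}
    (hv : v ∈ opSpan h) : termwise (LinearMap.mulLeft k g) v ∈ opSpan h := by
  suffices opSpan h ≤ (opSpan h).comap (termwise (LinearMap.mulLeft k g)) from this hv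
  refine Submodule.span_le.mpr ?_
  rintro _ ⟨⟨g', β⟩, rfl⟩
  change termwise _ (termwise _ h) ∈ opSpan h
  rw [← Module.End.mul_apply, ← map_mul, ← mul_assoc, mulLeft_mul_mulLeft]
  exact termwise_mem_opSpan _ _ h

theorem pd_mem_opSpan (i : Fin n) {h v : PolySeq (Fin n) k}
    (hv : v ∈ opSpan h) : termwise (pd i) v ∈ opSpan h := by
  suffices opSpan h ≤ (opSpan h).comap (termwise (pd i)) from this hv
  refine Submodule.span_le.mpr ?_
  rintro _ ⟨⟨g, β⟩, rfl⟩
  change termwise _ (termwise _ h) ∈ opSpan h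
  rw [← Module.End.mul_apply, ← map_mul, ← mul_assoc, pd_mul_mulLeft, add_mul, mul_assoc,
    pd_mul_dpow, map_add]
  exact add_mem (termwise_mem_opSpan _ _ h) (termwise_mem_opSpan _ _ h)

theorem dpow_mem_opSpan (β : Fin n →₀ ℕ) {h v : PolySeq (Fin n) k}
    (hv : v ∈ opSpan h) : termwise (dpow β) v ∈ opSpan h := by
  let S : Submonoid (Module.End k (MvPolynomial (Fin n) k)) :=
    { carrier := {φ | ∀ v ∈ opSpan h, termwise φ v ∈ opSpan h}
      one_mem' := fun v hv => hv
      mul_mem' := fun hφ hψ v hv => hφ _ (hψ v hv) }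
  refine (list_prod_mem (S := S) fun φ hφ => ?_ : dpow β ∈ S) v hv
  obtain ⟨i, rfl⟩ := List.mem_ofFn.mp hφ
  exact pow_mem (show pd i ∈ S from fun v hv => pd_mem_opSpan i hv) _

theorem mem_opSpan_self (h : PolySeq (Fin n) k) : h ∈ opSpan h := by
  have := termwise_mem_opSpan 1 0 h
  rwa [dpow_zero, mul_one, LinearMap.mulLeft_one] at this

theorem opSpan_mono {h h' : PolySeq (Fin n) k} (hh : h ∈ opSpan h') : opSpan h ≤ opSpan h' := by
  refine Submodule.span_le.mpr ?_
  rintro _ ⟨⟨g, β⟩, rfl⟩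
  change termwise _ h ∈ opSpan h'
  rw [map_mul, Module.End.mul_apply]
  exact mulLeft_mem_opSpan g (dpow_mem_opSpan β hh)

theorem mem_opSpan_iff {h w : PolySeq (Fin n) k} : w ∈ opSpan h ↔
    ∃ c : (Fin n →₀ ℕ) →₀ Polynomial (MvPolynomial (Fin n) k), ∀ m : ℕ,
      (c.sum fun β cβ => Polynomial.eval ((m : MvPolynomial (Fin n) k)) cβ * dpow β (h m)) =
        w m := by
  constructor
  · intro hw
    induction hw using Submodule.span_induction with
    | mem w hw =>
      obtain ⟨⟨g, β⟩, rfl⟩ := hw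
      exact ⟨Finsupp.single β (Polynomial.C g), fun m => by
        simp [termwise_apply]⟩
    | zero => exact ⟨0, fun m => rfl⟩
    | add v w _ _ hv hw =>
      obtain ⟨c, hc⟩ := hv
      obtain ⟨c', hc'⟩ := hw
      refine ⟨c + c', fun m => ?_⟩
      rw [Finsupp.sum_add_index' (by simp) (by simp [add_mul]), hc, hc', add_apply]
    | smul p w _ hw =>
      obtain ⟨c, hc⟩ := hw
      refine ⟨(p.map C : Polynomial (MvPolynomial (Fin n) k)) • c, fun m => ?_⟩
      rw [Finsupp.sum_smul_index (by simp), smul_apply, ← hc, Finsupp.mul_sum]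
      refine Finset.sum_congr rfl fun β _ => ?_
      beta_reduce
      rw [Polynomial.eval_mul, mul_assoc, ← map_natCast C m, Polynomial.eval_map_apply]
  · rintro ⟨c, hc⟩
    obtain rfl : (fun m : ℕ => c.sum fun β cβ =>
        Polynomial.eval ((m : MvPolynomial (Fin n) k)) cβ * dpow β (h m)) = w := funext hc
    clear hc
    induction c using Finsupp.induction_linear with
    | zero => exact zero_mem (opSpan h)
    | add c c' hc hc' =>
      refine mem_of_apply_eq (add_mem hc hc') fun m => ?_
      rw [Finsupp.sum_add_index' (by simp) (by simp [add_mul])]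
      rfl
    | single β q =>
      simp only [Finsupp.sum_single_index, Polynomial.eval_zero, zero_mul]
      induction q using Polynomial.induction_on' with
      | add p q hp hq =>
        refine mem_of_apply_eq (add_mem hp hq) fun m => ?_
        rw [Polynomial.eval_add, add_mul]
        rfl
      | monomial l g =>
        refine mem_of_apply_eq
          ((opSpan h).smul_mem (Polynomial.X ^ l) (termwise_mem_opSpan g β h)) fun m => ?_
        simp [smul_apply, termwise_apply, mul_left_comm, mul_assoc]

/-- The localization of `opSpan h`. -/
noncomputable def locSpan (h : PolySeq (Fin n) k) :
    Submodule (FractionRing (Polynomial k)) (Loc (Fin n) k) :=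
  (opSpan h).localized' _ (nonZeroDivisors (Polynomial k)) toLoc

theorem toLoc_mem_locSpan {h v : PolySeq (Fin n) k} (hv : v ∈ opSpan h) :
    toLoc v ∈ locSpan h :=
  ⟨v, hv, 1, by simp⟩

theorem locSpan_mono {h h' : PolySeq (Fin n) k} (hh : h ∈ opSpan h') :
    locSpan h ≤ locSpan h' := by
  rintro _ ⟨v, hv, s, rfl⟩
  exact ⟨v, opSpan_mono hh hv, s, rfl⟩

theorem locAct_mem_locSpan {φ : Module.End k (MvPolynomial (Fin n) k)} {h : PolySeq (Fin n) k}
    (hφ : ∀ v ∈ opSpan h, termwise φ v ∈ opSpan h) :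
    ∀ y ∈ locSpan h, locAct φ y ∈ locSpan h := by
  rintro _ ⟨v, hv, s, rfl⟩
  exact ⟨_, hφ v hv, s, (IsLocalizedModule.map_mk' _ _ _ _ _ _).symm⟩

theorem exists_smul_mem_opSpan {h v : PolySeq (Fin n) k} (hv : toLoc v ∈ locSpan h) :
    ∃ p : Polynomial k, p ≠ 0 ∧ p • v ∈ opSpan h := by
  obtain ⟨w, hw, s, hs⟩ := hv
  rw [IsLocalizedModule.mk'_eq_iff, Submonoid.smul_def, ← map_smul] at hs
  obtain ⟨u, hu⟩ := (IsLocalizedModule.eq_iff_exists (nonZeroDivisors (Polynomial k)) _).mp hs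
  refine ⟨(u * s : nonZeroDivisors (Polynomial k)), nonZeroDivisors.coe_ne_zero _, ?_⟩
  rw [Submonoid.coe_mul, mul_smul, ← Submonoid.smul_def u, ← hu]
  exact Submodule.smul_mem _ _ hw

theorem pow_succ_eq (f : MvPolynomial (Fin n) k) (a : ℕ) :
    pow f (a + 1) = termwise (LinearMap.mulLeft k f) (pow f a) :=
  _root_.funext fun m => by
    rw [termwise_apply, LinearMap.mulLeft_apply, pow, pow, ← add_assoc, pow_succ']

theorem termwise_mulLeft_pow_succ (f u : MvPolynomial (Fin n) k) (a : ℕ) :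
    termwise (LinearMap.mulLeft k u) (pow f (a + 1)) =
      termwise (LinearMap.mulLeft k (u * f)) (pow f a) := by
  rw [pow_succ_eq, ← Module.End.mul_apply, ← map_mul, mulLeft_mul_mulLeft]

theorem termwise_pd_mulLeft_pow_succ (f u : MvPolynomial (Fin n) k) (i : Fin n) (a : ℕ) :
    termwise (pd i) (termwise (LinearMap.mulLeft k u) (pow f (a + 1))) =
      termwise (LinearMap.mulLeft k (pderiv i u * f)) (pow f a) +
      (Polynomial.X + Polynomial.C ((a : k) + 1)) •
        termwise (LinearMap.mulLeft k (u * pderiv i f)) (pow f a) :=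
  _root_.funext fun m => by
    rw [add_apply, smul_apply]
    simp only [termwise_apply, LinearMap.mulLeft_apply, pow, pd, ← add_assoc]
    change pderiv i (u * f ^ (m + a + 1)) = _
    rw [pderiv_mul, pderiv_pow, Nat.add_sub_cancel]
    simp only [Polynomial.eval_add, Polynomial.eval_X, map_add, map_natCast,
      map_one, Nat.cast_add, Nat.cast_one, Polynomial.eval_natCast, Polynomial.eval_one]
    ring

/-- A filtration of the localized module of sequences, by the order of the pole along `f`,
up to step `T`. -/
noncomputable def poleFiltration (f : MvPolynomial (Fin n) k) (L T i : ℕ) :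
    Submodule (FractionRing (Polynomial k)) (Loc (Fin n) k) :=
  if i ≤ T then Submodule.span _ {y | ∃ u : MvPolynomial (Fin n) k,
    u.totalDegree ≤ (i + L) * (f.totalDegree + 1) ∧
      y = toLoc (termwise (LinearMap.mulLeft k u) (pow f (T - i)))}
  else ⊤

variable {f : MvPolynomial (Fin n) k} {L T : ℕ}

theorem mem_poleFiltration {i a : ℕ} {u : MvPolynomial (Fin n) k}
    (hu : u.totalDegree ≤ (i + L) * (f.totalDegree + 1)) (ha : i + a = T) :
    toLoc (termwise (LinearMap.mulLeft k u) (pow f a)) ∈ poleFiltration f L T i := by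
  rw [poleFiltration, if_pos (by omega)]
  exact Submodule.subset_span ⟨u, hu, by rw [← ha, Nat.add_sub_cancel_left]⟩

theorem map_mem_poleFiltration
    {φ : Module.End (FractionRing (Polynomial k)) (Loc (Fin n) k)} {i : ℕ}
    (hφ : ∀ a, ∀ u : MvPolynomial (Fin n) k, u.totalDegree ≤ (i + L) * (f.totalDegree + 1) →
      i + 1 + a = T →
      φ (toLoc (termwise (LinearMap.mulLeft k u) (pow f (a + 1)))) ∈ poleFiltration f L T (i + 1)) :
    ∀ y ∈ poleFiltration f L T i, φ y ∈ poleFiltration f L T (i + 1) := by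
  by_cases hi : i + 1 ≤ T
  · obtain ⟨a, ha⟩ := exists_add_of_le hi
    suffices poleFiltration f L T i ≤ (poleFiltration f L T (i + 1)).comap φ from this
    rw [poleFiltration, if_pos (by omega)]
    refine Submodule.span_le.mpr ?_
    rintro _ ⟨u, hu, rfl⟩
    rw [show T - i = a + 1 by omega]
    exact hφ a u hu ha.symm
  · intro y _
    rw [poleFiltration, if_neg hi]
    trivial

theorem monotone_poleFiltration : Monotone (poleFiltration f L T) := by
  refine monotone_nat_of_le_succ fun i => ?_
  refine map_mem_poleFiltration (φ := 1) fun a u hu ha => ?_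
  rw [Module.End.one_apply, termwise_mulLeft_pow_succ]
  refine mem_poleFiltration ((totalDegree_mul _ _).trans ?_) ha
  nlinarith

theorem X_mem_poleFiltration (l : Fin n) (i : ℕ) : ∀ y ∈ poleFiltration f L T i,
    locAct (LinearMap.mulLeft k (X l)) y ∈ poleFiltration f L T (i + 1) := by
  refine map_mem_poleFiltration fun a u hu ha => ?_
  rw [locAct_toLoc, ← Module.End.mul_apply, ← map_mul, mulLeft_mul_mulLeft,
    termwise_mulLeft_pow_succ]
  refine mem_poleFiltration ?_ ha
  have h1 := totalDegree_mul (X l * u) f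
  have h2 := totalDegree_mul (X l) u
  rw [totalDegree_X] at h2
  nlinarith

theorem pd_mem_poleFiltration (l : Fin n) (i : ℕ) : ∀ y ∈ poleFiltration f L T i,
    locAct (pd l) y ∈ poleFiltration f L T (i + 1) := by
  refine map_mem_poleFiltration fun a u hu ha => ?_
  rw [locAct_toLoc, termwise_pd_mulLeft_pow_succ, map_add, map_smul, ← algebraMap_smul
    (FractionRing (Polynomial k))]
  refine add_mem (mem_poleFiltration ?_ ha) (Submodule.smul_mem _ _ (mem_poleFiltration ?_ ha))
  · have h1 := totalDegree_mul (pderiv l u) f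
    have h2 := totalDegree_pderiv_le l u
    have h3 := Nat.sub_le u.totalDegree 1
    nlinarith
  · have h1 := totalDegree_mul u (pderiv l f)
    have h2 := totalDegree_pderiv_le l f
    have h3 := Nat.sub_le f.totalDegree 1
    nlinarith

theorem toLoc_pow_mem_poleFiltration {j : ℕ} (hj : j ≤ L) :
    toLoc (pow f (T + j)) ∈ poleFiltration f L T 0 := by
  have h : pow f (T + j) = termwise (LinearMap.mulLeft k (f ^ j)) (pow f T) :=
    _root_.funext fun m => by
      rw [termwise_apply, LinearMap.mulLeft_apply, pow, pow, ← add_assoc, pow_add _ _ j, mul_comm]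
  rw [h]
  refine mem_poleFiltration ((totalDegree_pow _ _).trans ?_) (zero_add T)
  rw [zero_add]
  exact Nat.mul_le_mul hj (Nat.le_succ _)

theorem poleFiltration_le_span : poleFiltration f L T T ≤
    Submodule.span _ (Set.range fun γ : Fin n → Fin ((T + L) * (f.totalDegree + 1) + 1) =>
      toLoc (termwise (LinearMap.mulLeft k
        (monomial (Finsupp.equivFunOnFinite.symm fun i => (γ i : ℕ)) 1)) (pow f 0))) := by
  rw [poleFiltration, if_pos le_rfl, Nat.sub_self]
  refine Submodule.span_le.mpr ?_
  rintro _ ⟨u, hu, rfl⟩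
  have hsum : termwise (LinearMap.mulLeft k u) (pow f 0) = ∑ γ ∈ u.support,
      Polynomial.C (coeff γ u) • termwise (LinearMap.mulLeft k (monomial γ 1)) (pow f 0) := by
    have hC : ∀ γ ∈ u.support,
        Polynomial.C (coeff γ u) • termwise (LinearMap.mulLeft k (monomial γ 1)) (pow f 0) =
          termwise (LinearMap.mulLeft k (monomial γ (coeff γ u))) (pow f 0) := fun γ _ =>
      _root_.funext fun m => by
        rw [smul_apply, termwise_apply, termwise_apply, Polynomial.eval_C,
          LinearMap.mulLeft_apply, LinearMap.mulLeft_apply, ← mul_assoc, C_mul_monomial, mul_one]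
    rw [Finset.sum_congr rfl hC, ← LinearMap.sum_apply, ← map_sum]
    congr 2
    refine LinearMap.ext fun p => ?_
    rw [LinearMap.sum_apply]
    simp only [LinearMap.mulLeft_apply]
    rw [← Finset.sum_mul, ← as_sum]
  rw [hsum, map_sum]
  refine Submodule.sum_mem _ fun γ hγ => ?_
  rw [map_smul, ← algebraMap_smul (FractionRing (Polynomial k))]
  refine Submodule.smul_mem _ _ (Submodule.subset_span ⟨fun i => ⟨γ i, ?_⟩, ?_⟩)
  · refine Nat.lt_succ_of_le (((Finsupp.le_degree i γ).trans ?_).trans hu)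
    exact le_totalDegree hγ
  · exact congrArg (fun δ => toLoc (termwise (LinearMap.mulLeft k (monomial δ 1)) (pow f 0)))
      (Finsupp.ext fun _ => rfl)

theorem finite_poleFiltration :
    Module.Finite (FractionRing (Polynomial k)) (poleFiltration f L T T) :=
  have := FiniteDimensional.span_of_finite (FractionRing (Polynomial k)) (Set.finite_range
    fun γ : Fin n → Fin ((T + L) * (f.totalDegree + 1) + 1) => toLoc (termwise (LinearMap.mulLeft k
      (monomial (Finsupp.equivFunOnFinite.symm fun i => (γ i : ℕ)) 1)) (pow f 0)))
  Submodule.finiteDimensional_of_le poleFiltration_le_span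

theorem finrank_poleFiltration_le :
    Module.finrank (FractionRing (Polynomial k)) (poleFiltration f L T T) ≤
      ((T + L) * (f.totalDegree + 1) + 1) ^ n := by
  have := FiniteDimensional.span_of_finite (FractionRing (Polynomial k)) (Set.finite_range
    fun γ : Fin n → Fin ((T + L) * (f.totalDegree + 1) + 1) => toLoc (termwise (LinearMap.mulLeft k
      (monomial (Finsupp.equivFunOnFinite.symm fun i => (γ i : ℕ)) 1)) (pow f 0)))
  refine (Submodule.finrank_mono poleFiltration_le_span).trans ((finrank_range_le_card _).trans ?_)
  simp

theorem exists_toLoc_pow_mem_locSpan [CharZero k] (f : MvPolynomial (Fin n) k) :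
    ∃ a, toLoc (pow f a) ∈ locSpan (pow f (a + 1)) := by
  set B := (4 * n + 1) * (f.totalDegree + 1) + 1 with hB
  have hcard : Fintype.card (Fin n) = n := Fintype.card_fin n
  set T := 2 * (2 * Fintype.card (Fin n) * B ^ n) with hT
  have hsucc : ∀ a, pow f (a + 1) ∈ opSpan (pow f a) := fun a => by
    rw [pow_succ_eq]
    exact mulLeft_mem_opSpan f (mem_opSpan_self _)
  have : CharZero (FractionRing (Polynomial k)) :=
    charZero_of_injective_algebraMap (IsFractionRing.injective (Polynomial k) _)
  obtain ⟨j, -, hj⟩ := exists_mem_succ_of_finrank_lt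
    (fun i : Fin n => locAct (LinearMap.mulLeft k (X i))) (fun i => locAct (pd i))
    (fun i j => by rw [← map_mul, ← map_mul, mulLeft_mul_mulLeft, mulLeft_mul_mulLeft, mul_comm])
    (fun i j => by rw [← map_mul, ← map_mul, pd_mul_pd_comm])
    (fun i j => by
      rw [← map_mul, ← map_mul, pd_mul_mulLeft, map_add, pderiv_X, Pi.single_apply]
      by_cases hij : i = j
      · rw [if_pos hij, if_pos hij.symm, LinearMap.mulLeft_one]
        congr 1
        exact map_one locAct
      · rw [if_neg hij, if_neg (Ne.symm hij), LinearMap.mulLeft_zero_eq_zero, map_zero])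
    (poleFiltration f (B ^ n + 1) T) monotone_poleFiltration
    X_mem_poleFiltration pd_mem_poleFiltration
    (fun j => locSpan (pow f (T + j)))
    (antitone_nat_of_succ_le fun j => locSpan_mono (hsucc _))
    (fun i m => locAct_mem_locSpan fun v hv => mulLeft_mem_opSpan _ hv)
    (fun i m => locAct_mem_locSpan fun v hv => pd_mem_opSpan i hv)
    (B ^ n) (B ^ n + 1) finite_poleFiltration
    (finrank_poleFiltration_le.trans_lt (by
      rw [hcard, Nat.succ_mul]
      have h : (T + (B ^ n + 1)) * (f.totalDegree + 1) + 1 ≤ B * (B ^ n + 1) := by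
        have h' : ∀ N : ℕ, (2 * (2 * n * N) + (N + 1)) * (f.totalDegree + 1) + 1 ≤
            ((4 * n + 1) * (f.totalDegree + 1) + 1) * (N + 1) := fun N => by
          nlinarith [Nat.zero_le (n * (f.totalDegree + 1))]
        rw [hT, hcard]
        exact h' (B ^ n)
      refine (Nat.pow_le_pow_left h n).trans_lt ?_
      rw [mul_pow]
      exact Nat.lt_add_of_pos_right (by positivity)))
    (fun j => toLoc (pow f (T + j)))
    (fun j hj => toLoc_pow_mem_poleFiltration hj.le)
    (fun j _ => toLoc_mem_locSpan (mem_opSpan_self _))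
  exact ⟨T + j, hj⟩

theorem exists_smul_pow_mem_opSpan [CharZero k] (f : MvPolynomial (Fin n) k) :
    ∃ b : Polynomial k, b ≠ 0 ∧ b • pow f 0 ∈ opSpan (pow f 1) := by
  obtain ⟨a, ha⟩ := exists_toLoc_pow_mem_locSpan f
  obtain ⟨p, hp, hmem⟩ := exists_smul_mem_opSpan ha
  obtain ⟨c, hc⟩ := mem_opSpan_iff.mp hmem
  let R := MvPolynomial (Fin n) k
  refine ⟨p.comp (Polynomial.X - Polynomial.C (a : k)) * descPochhammer k a,
    mul_ne_zero ?_ (monic_descPochhammer k a).ne_zero, mem_opSpan_iff.mpr ?_⟩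
  · rw [sub_eq_add_neg, ← map_neg]
    exact Polynomial.comp_X_add_C_ne_zero_iff.mpr hp
  refine ⟨c.mapRange (fun q => q.comp (Polynomial.X - Polynomial.C (a : R)) * descPochhammer R a)
    (by simp), fun m => ?_⟩
  rw [Finsupp.sum_mapRange_index (by simp), smul_apply]
  rcases lt_or_ge m a with hm | hm
  · have h : (descPochhammer R a).eval (m : R) = 0 := descPochhammer_eval_coe_nat_of_lt hm
    simp only [Polynomial.eval_mul, descPochhammer_eval_coe_nat_of_lt hm, h, mul_zero, zero_mul,
      map_zero]
    exact Finset.sum_const_zero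
  · obtain ⟨m, rfl⟩ := exists_add_of_le hm
    have hD : C ((descPochhammer k a).eval ((a + m : ℕ) : k)) =
        (descPochhammer R a).eval ((a + m : ℕ) : R) := by
      rw [← descPochhammer_map (C : k →+* R), ← map_natCast (C : k →+* R),
        Polynomial.eval_map_apply]
    have hpow : pow f 0 (a + m) = pow f a m := congrArg (f ^ ·) (add_comm a m)
    have hpow_succ : pow f 1 (a + m) = pow f (a + 1) m := congrArg (f ^ ·) (by omega)
    have hcm := hc m
    rw [smul_apply] at hcm
    rw [Polynomial.eval_mul, map_mul, hD, mul_right_comm, mul_comm _ (Polynomial.eval _ _),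
      Polynomial.eval_comp, Polynomial.eval_sub, Polynomial.eval_X, Polynomial.eval_C,
      Nat.cast_add (R := k), add_sub_cancel_left, hpow, ← hcm, Finsupp.mul_sum]
    refine Finset.sum_congr rfl fun β _ => ?_
    simp only [Polynomial.eval_mul, Polynomial.eval_comp, Polynomial.eval_sub, Polynomial.eval_X,
      Polynomial.eval_C, Nat.cast_add, add_sub_cancel_left, hpow_succ]
    ring

end PolySeq

theorem exists_unique_monic_span_eq {I : Ideal (Polynomial k)} (hI : I ≠ ⊥) :
    ∃! g : Polynomial k, g.Monic ∧ I = Ideal.span {g} := by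
  classical
  obtain ⟨g, rfl⟩ := (IsPrincipalIdealRing.principal I).principal
  rw [Ideal.submodule_span_eq] at hI ⊢
  have hg : g ≠ 0 := by
    rintro rfl
    simp at hI
  refine ⟨normalize g, ⟨Polynomial.monic_normalize hg,
    Ideal.span_singleton_eq_span_singleton.mpr (normalize_associated g).symm⟩, ?_⟩
  rintro g' ⟨hg', h⟩
  exact Polynomial.eq_of_monic_of_associated hg' (Polynomial.monic_normalize hg)
    ((Ideal.span_singleton_eq_span_singleton.mp h).symm.trans (normalize_associated g).symm)

/-- Uniqueness infrastructure for Theorem 6.4 / equation (2): for nonzero `f`, the set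
`B_f` of polynomials `b` admitting an operator `c` with
`Σ_β c_β(m)·∂^β(f^{m+1}) = b(m)·f^m` for all `m ∈ ℕ` is an ideal of `K[X]`; being
nonzero (by Bernstein's theorem), it has a unique monic generator — the Bernstein–Sato
polynomial `b_f` of `f`. -/
theorem bernstein_sato_ideal (hn : 0 < n)
    (f : MvPolynomial (Fin n) K) (hf : f ≠ 0) :
    ∃ I : Ideal (Polynomial K),
      (∀ b : Polynomial K,
        b ∈ I ↔ ∃ c : (Fin n →₀ ℕ) →₀ Polynomial (MvPolynomial (Fin n) K),
          ∀ m : ℕ,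
            (c.sum fun β cβ =>
                Polynomial.eval ((m : MvPolynomial (Fin n) K)) cβ * dpow β (f ^ (m + 1))) =
              C (Polynomial.eval (m : K) b) * f ^ m) ∧
      I ≠ ⊥ ∧
      ∃! g : Polynomial K, g.Monic ∧ I = Ideal.span {g} := by
  refine ⟨(PolySeq.opSpan (PolySeq.pow f 1)).comap
    (LinearMap.toSpanSingleton (Polynomial K) _ (PolySeq.pow f 0)), fun b => ?_, ?_⟩
  · exact PolySeq.mem_opSpan_iff
  · have hne : (PolySeq.opSpan (PolySeq.pow f 1)).comap
        (LinearMap.toSpanSingleton (Polynomial K) _ (PolySeq.pow f 0)) ≠ ⊥ := by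
      obtain ⟨b, hb, hmem⟩ := PolySeq.exists_smul_pow_mem_opSpan f
      exact fun h => hb ((Submodule.eq_bot_iff _).mp h b hmem)
    exact ⟨hne, exists_unique_monic_span_eq hne⟩
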